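/- Let R be a local ring containing 1/2 (if R is not a field, assume its residue field has at least 5 elements). In the Witt K-theory ring KW_*(R): (i) [a]·[a] = [a]·[−1] for every unit a of R; and (ii) [ab²] = [a] for all units a, b of R; in particular [b²] = 0 for every unit b. -/

import Mathlib

/-- The defining relations of the Witt `K`-theory ring of `R`: the generator `[a]`
(for `a ∈ Rˣ`) is encoded as `some a` (in degree `1`), and the generator `η` as
`none` (in degree `-1`). -/
inductive KWRel (R : Type) [CommRing R] :
    FreeAlgebra ℤ (Option Rˣ) → FreeAlgebra ℤ (Option Rˣ) → Prop
  /-- (WK1) `η·[a] = [a]·η`. -/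
  | comm (a : Rˣ) : KWRel R (FreeAlgebra.ι ℤ none * FreeAlgebra.ι ℤ (some a))
      (FreeAlgebra.ι ℤ (some a) * FreeAlgebra.ι ℤ none)
  /-- (WK2) `[ab] = [a] + [b] - η·[a]·[b]`. -/
  | mul (a b : Rˣ) : KWRel R (FreeAlgebra.ι ℤ (some (a * b)))
      (FreeAlgebra.ι ℤ (some a) + FreeAlgebra.ι ℤ (some b) -
        FreeAlgebra.ι ℤ none * FreeAlgebra.ι ℤ (some a) * FreeAlgebra.ι ℤ (some b))
  /-- (WK3) `[a]·[1-a] = 0` for `a, 1-a ∈ Rˣ`. -/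
  | steinberg (a b : Rˣ) (h : (a : R) + (b : R) = 1) :
      KWRel R (FreeAlgebra.ι ℤ (some a) * FreeAlgebra.ι ℤ (some b)) 0
  /-- (WK4) `2 = η·[-1]`. -/
  | hyperbolic : KWRel R 2 (FreeAlgebra.ι ℤ none * FreeAlgebra.ι ℤ (some (-1)))

/-- The Witt `K`-theory ring `KW_*(R)` of `R`: the quotient of the free `ℤ`-algebra on
generators `[a]` (`a ∈ Rˣ`, degree `1`) and `η` (degree `-1`) by the two-sided ideal
generated by the relations (WK1)–(WK4). -/
def KW (R : Type) [CommRing R] := RingQuot (KWRel R)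

noncomputable instance (R : Type) [CommRing R] : Ring (KW R) :=
  inferInstanceAs (Ring (RingQuot (KWRel R)))

namespace KW

variable (R : Type) [CommRing R]

/-- The degree-one generator `[a]` of `KW_*(R)`. -/
noncomputable def gen (a : Rˣ) : KW R :=
  RingQuot.mkRingHom (KWRel R) (FreeAlgebra.ι ℤ (some a))

/-- The degree-minus-one generator `η` of `KW_*(R)`. -/
noncomputable def eta : KW R :=
  RingQuot.mkRingHom (KWRel R) (FreeAlgebra.ι ℤ none)

/-- `⟨a⟩ := 1 - η·[a]` in `KW_0(R)`. -/
noncomputable def gu (a : Rˣ) : KW R := 1 - eta R * gen R a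

end KW

namespace KW

variable {R : Type} [CommRing R]

theorem eta_mul_gen (a : Rˣ) : eta R * gen R a = gen R a * eta R := by
  have h := RingQuot.mkRingHom_rel (KWRel.comm a)
  simp only [map_mul] at h
  exact h

theorem gen_mul (a b : Rˣ) :
    gen R (a * b) = gen R a + gen R b - eta R * gen R a * gen R b := by
  have h := RingQuot.mkRingHom_rel (KWRel.mul a b)
  simp only [map_mul, map_add, map_sub] at h
  exact h

theorem gen_mul_gen_of_add_eq_one (a b : Rˣ) (h : (a : R) + (b : R) = 1) :
    gen R a * gen R b = 0 := by
  have h' := RingQuot.mkRingHom_rel (KWRel.steinberg a b h)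
  simp only [map_mul, map_zero] at h'
  exact h'

variable (R) in
theorem eta_mul_gen_neg_one : eta R * gen R (-1) = 2 := by
  have h := RingQuot.mkRingHom_rel (KWRel.hyperbolic (R := R))
  simp only [map_mul, map_ofNat] at h
  exact h.symm

theorem eta_mul_gen_mul_gen_comm (a b : Rˣ) :
    eta R * gen R a * gen R b = eta R * gen R b * gen R a := by
  have h := gen_mul a b
  rw [mul_comm a b, gen_mul b a, add_comm] at h
  exact (sub_right_injective h).symm

theorem gen_mul_eq_add_gu_mul (a b : Rˣ) : gen R (a * b) = gen R a + gu R a * gen R b := by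
  rw [gen_mul, gu]
  noncomm_ring

theorem gu_mul (a b : Rˣ) : gu R (a * b) = gu R a * gu R b := by
  have h : gen R a * (eta R * gen R b) = eta R * gen R a * gen R b := by
    rw [eta_mul_gen a, mul_assoc]
  simp only [gu, gen_mul, mul_sub, sub_mul, mul_add, mul_one, one_mul, mul_assoc, h]
  noncomm_ring

theorem gu_commute_gen (a b : Rˣ) : Commute (gu R a) (gen R b) := by
  have h : gen R b * (eta R * gen R a) = eta R * gen R a * gen R b := by
    rw [eta_mul_gen_mul_gen_comm, eta_mul_gen b, mul_assoc]
  rw [Commute, SemiconjBy, gu, sub_mul, mul_sub, h, one_mul, mul_one]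

variable (R) in
theorem gu_neg_one : gu R (-1) = -1 := by
  rw [gu, eta_mul_gen_neg_one]
  norm_num

variable (R) in
theorem gu_one : gu R 1 = 1 := by
  have h := gu_mul (-1 : Rˣ) (-1)
  rwa [gu_neg_one, neg_mul_neg, neg_mul_neg, one_mul, one_mul] at h

variable (R) in
theorem gen_one : gen R 1 = 0 := by
  have h := gen_mul_eq_add_gu_mul (1 : Rˣ) 1
  rw [gu_one, one_mul, one_mul] at h
  exact left_eq_add.mp h

theorem gen_eq_neg_gu_mul_gen_inv (a : Rˣ) : gen R a = -(gu R a * gen R a⁻¹) := by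
  have h := gen_mul_eq_add_gu_mul a a⁻¹
  rw [mul_inv_cancel, gen_one] at h
  exact eq_neg_of_add_eq_zero_left h.symm

theorem gen_neg (a : Rˣ) : gen R (-a) = gen R (-1) - gen R a := by
  rw [← neg_one_mul, gen_mul_eq_add_gu_mul, gu_neg_one, neg_one_mul, sub_eq_add_neg]

theorem gen_mul_gen_neg_of_isUnit {a : Rˣ} (ha : IsUnit (1 - (a : R))) :
    gen R a * gen R (-a) = 0 := by
  obtain ⟨c, hc⟩ := ha
  have hd : ((-a⁻¹ * c : Rˣ) : R) = 1 - (a⁻¹ : Rˣ) := by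
    push_cast
    rw [hc, mul_sub, neg_mul, neg_mul, Units.inv_mul]
    ring
  have hac : gen R a * gen R c = 0 :=
    gen_mul_gen_of_add_eq_one _ _ (by rw [hc]; ring)
  have had : gen R a⁻¹ * gen R (-a⁻¹ * c) = 0 :=
    gen_mul_gen_of_add_eq_one _ _ (by rw [hd]; ring)
  have hfac : c = -a * (-a⁻¹ * c) := by
    rw [← mul_assoc, neg_mul_neg, mul_inv_cancel, one_mul]
  have h := gen_mul_eq_add_gu_mul (-a) (-a⁻¹ * c)
  rw [← hfac] at h
  rw [eq_sub_of_add_eq h.symm, mul_sub, hac, zero_sub, ← mul_assoc,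
    ← (gu_commute_gen (-a) a).eq, mul_assoc, gen_eq_neg_gu_mul_gen_inv a, neg_mul,
    mul_assoc (gu R a), had, mul_zero, neg_zero, mul_zero, neg_zero]

theorem gen_mul_self_of_isUnit {a : Rˣ} (ha : IsUnit (1 - (a : R))) :
    gen R a * gen R a = gen R a * gen R (-1) := by
  have h := gen_mul_gen_neg_of_isUnit ha
  rw [gen_neg, mul_sub, sub_eq_zero] at h
  exact h.symm

theorem eta_mul_gen_mul_gen_neg_one (a : Rˣ) : eta R * gen R a * gen R (-1) = 2 * gen R a := by
  rw [eta_mul_gen_mul_gen_comm, eta_mul_gen_neg_one]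

theorem gen_sq_of_isUnit {a : Rˣ} (ha : IsUnit (1 - (a : R))) : gen R (a ^ 2) = 0 := by
  rw [sq, gen_mul, mul_assoc, gen_mul_self_of_isUnit ha, ← mul_assoc,
    eta_mul_gen_mul_gen_neg_one, two_mul, sub_self]

/-- Comparison of `[ab]·[ab]` with `[ab]·[-1]`, using that `[a²] = [b²] = 0`. -/
theorem gen_mul_self_add_gen_mul_self {a b : Rˣ} (ha : gen R (a ^ 2) = 0)
    (hb : gen R (b ^ 2) = 0)
    (hab : gen R (a * b) * gen R (a * b) = gen R (a * b) * gen R (-1)) :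
    gen R a * gen R a + gen R b * gen R b + gen R a * gen R b =
      gen R a * gen R (-1) + gen R b * gen R (-1) + gen R b * gen R a := by
  have add_gen_self {c : Rˣ} (hc : gen R (c ^ 2) = 0) :
      eta R * gen R c * gen R c = gen R c + gen R c := by
    rw [sq, gen_mul, sub_eq_zero] at hc
    exact hc.symm
  have ha := add_gen_self ha
  have hb := add_gen_self hb
  have hYe := eta_mul_gen_mul_gen_neg_one b
  have hc := eta_mul_gen_mul_gen_comm a b
  have hnX := eta_mul_gen a
  have hnY := eta_mul_gen b
  rw [gen_mul] at hab
  generalize gen R a = X at *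
  generalize gen R b = Y at *
  generalize eta R = n at *
  generalize gen R (-1) = e at *
  have h1 : X * (n * X * Y) = X * Y + X * Y := by
    rw [← add_mul, ← ha, hnX]; simp only [mul_assoc]; rw [← mul_assoc n X, hnX, mul_assoc]
  have h2 : Y * (n * X * Y) = Y * X + Y * X := by
    rw [hc, ← add_mul, ← hb, hnY]; simp only [mul_assoc]; rw [← mul_assoc n Y, hnY, mul_assoc]
  have h3 : n * X * Y * X = X * Y + X * Y := by
    rw [hnX, mul_assoc X, mul_assoc, ← hc, h1]
  have h4 : n * X * Y * Y = X * Y + X * Y := by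
    rw [hnX, mul_assoc X, mul_assoc, hb, mul_add]
  have h5 : n * X * Y * (n * X * Y) = X * Y + X * Y + (X * Y + X * Y) := by
    rw [mul_assoc (n * X), h2, mul_add, ← mul_assoc, h3]
  have h6 : n * X * Y * e = X * Y + X * Y := by
    rw [hnX, mul_assoc X, mul_assoc, hYe, two_mul, mul_add]
  simp only [mul_sub, sub_mul, mul_add, add_mul, h1, h2, h3, h4, h5, h6] at hab
  rw [← sub_eq_zero] at hab ⊢
  rw [← hab]
  abel

theorem gen_commute_of_isUnit {a b : Rˣ} (ha : IsUnit (1 - (a : R))) (hb : IsUnit (1 - (b : R)))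
    (hab : IsUnit (1 - ((a * b : Rˣ) : R))) : Commute (gen R a) (gen R b) := by
  have h := gen_mul_self_add_gen_mul_self (gen_sq_of_isUnit ha) (gen_sq_of_isUnit hb)
    (gen_mul_self_of_isUnit hab)
  rw [gen_mul_self_of_isUnit ha, gen_mul_self_of_isUnit hb] at h
  exact add_left_cancel h

theorem gen_mul_self_of_commute {a b : Rˣ} (ha : gen R (a ^ 2) = 0)
    (hb : IsUnit (1 - (b : R))) (hab : IsUnit (1 - ((a * b : Rˣ) : R)))
    (h : Commute (gen R a) (gen R b)) :
    gen R a * gen R a = gen R a * gen R (-1) := by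
  have h' := gen_mul_self_add_gen_mul_self ha (gen_sq_of_isUnit hb) (gen_mul_self_of_isUnit hab)
  rw [gen_mul_self_of_isUnit hb, h.eq] at h'
  exact add_right_cancel (add_right_cancel h')

section IsLocalRing

open IsLocalRing

variable [IsLocalRing R]

theorem isUnit_one_sub_iff (a : R) : IsUnit (1 - a) ↔ residue R a ≠ 1 := by
  rw [← residue_ne_zero_iff_isUnit, map_sub, map_one, sub_ne_zero, ne_comm]

theorem residue_one_ne_neg_one [Invertible (2 : R)] : (1 : ResidueField R) ≠ -1 := by
  intro h
  have h2 : residue R 2 ≠ 0 := (residue_ne_zero_iff_isUnit 2).mpr (isUnit_of_invertible 2)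
  apply h2
  rw [map_ofNat, ← one_add_one_eq_two]
  nth_rewrite 2 [h]
  exact add_neg_cancel 1

theorem gen_sq [Invertible (2 : R)] (a : Rˣ) : gen R (a ^ 2) = 0 := by
  by_cases ha : residue R a = 1
  · rw [← neg_sq]
    apply gen_sq_of_isUnit
    rw [isUnit_one_sub_iff, Units.val_neg, map_neg, ha]
    exact residue_one_ne_neg_one.symm
  · exact gen_sq_of_isUnit ((isUnit_one_sub_iff _).mpr ha)

theorem exists_unit_residue_ne (h : 5 ≤ Cardinal.mk (ResidueField R)) :
    ∃ b : Rˣ, residue R b ≠ 1 ∧ residue R b ≠ -1 := by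
  classical
  obtain ⟨x, hx⟩ : ∃ x : ResidueField R, x ∉ ({0, 1, -1} : Finset (ResidueField R)) := by
    by_contra! hs
    have hle : Cardinal.mk (ResidueField R) ≤ 3 := by
      have huniv : ((({0, 1, -1} : Finset (ResidueField R)) : Set (ResidueField R))) = Set.univ :=
        Set.eq_univ_of_forall hs
      rw [← Cardinal.mk_univ, ← huniv]
      exact Cardinal.mk_coe_finset.trans_le (by exact_mod_cast Finset.card_le_three)
    exact absurd (h.trans hle) (by norm_num)
  simp only [Finset.mem_insert, Finset.mem_singleton, not_or] at hx
  obtain ⟨r, rfl⟩ := residue_surjective x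
  obtain ⟨b, rfl⟩ := (residue_ne_zero_iff_isUnit r).mp hx.1
  exact ⟨b, hx.2⟩

theorem gen_mul_self_of_residue_eq_one [Invertible (2 : R)]
    (h : 5 ≤ Cardinal.mk (ResidueField R)) {a : Rˣ} (ha : residue R a = 1) :
    gen R a * gen R a = gen R a * gen R (-1) := by
  obtain ⟨b, hb, hb'⟩ := exists_unit_residue_ne h
  have h2 : (-1 : ResidueField R) ≠ 1 := residue_one_ne_neg_one.symm
  have hnb : -residue R b ≠ 1 := fun h => hb' (by rw [← h, neg_neg])
  have hb1 : IsUnit (1 - (b : R)) := (isUnit_one_sub_iff _).mpr hb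
  have hneg : Commute (gen R (-1)) (gen R b) := by
    apply gen_commute_of_isUnit _ hb1 <;> rw [isUnit_one_sub_iff] <;> simpa
  have hnega : Commute (gen R (-a)) (gen R b) := by
    apply gen_commute_of_isUnit _ hb1 <;> rw [isUnit_one_sub_iff] <;> simpa [ha]
  apply gen_mul_self_of_commute (gen_sq a) hb1 ((isUnit_one_sub_iff _).mpr (by simpa [ha]))
  rw [← neg_neg a, gen_neg]
  exact hneg.sub_left hnega

end IsLocalRing

end KW

open IsLocalRing in
/-- **Statement 9.** Let `R` be a local ring containing `1/2` (if `R` is not a field its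
residue field has at least 5 elements).  In `KW_*(R)`:
(i) `[a]·[a] = [a]·[-1]` for every unit `a`, and
(ii) `[a·b²] = [a]` for all units `a, b`; in particular `[b²] = 0` for every unit `b`. -/
theorem statement9 (R : Type) [CommRing R] [IsLocalRing R] [Invertible (2 : R)]
    (hR : IsField R ∨ 5 ≤ Cardinal.mk (ResidueField R)) :
    (∀ a : Rˣ, KW.gen R a * KW.gen R a = KW.gen R a * KW.gen R (-1)) ∧
    (∀ a b : Rˣ, KW.gen R (a * b ^ 2) = KW.gen R a) ∧
    (∀ b : Rˣ, KW.gen R (b ^ 2) = 0) := by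
  refine ⟨fun a => ?_, fun a b => ?_, KW.gen_sq⟩
  · by_cases ha : residue R a = 1
    · obtain hF | hc := hR
      · have ha1 : a = 1 := by
          by_contra hne
          obtain ⟨c, hc⟩ := hF.mul_inv_cancel (a := 1 - (a : R))
            (fun h => hne (Units.ext (sub_eq_zero.mp h).symm))
          exact (KW.isUnit_one_sub_iff _).mp (IsUnit.of_mul_eq_one c hc) ha
        rw [ha1, KW.gen_one, zero_mul, zero_mul]
      · exact KW.gen_mul_self_of_residue_eq_one hc ha
    · exact KW.gen_mul_self_of_isUnit ((KW.isUnit_one_sub_iff _).mpr ha)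
  · rw [KW.gen_mul, KW.gen_sq, add_zero, mul_zero, sub_zero]
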